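/- Let m > 1, τ ≥ 0, and let c, ρ be smooth mean-zero functions on 𝕋², with Φ = Λ^{-2}ρ. Then |(e^{τΛ}Λ^m ∇·(c∇Φ), e^{τΛ}Λ^m c)_{L²}| ≤ (1/8)δ‖Λ^{m+1}e^{τΛ}c‖²_{L²} + C(δ,m)[‖Λ^{m-1}ρ‖²_{L²}‖Λ^m e^{τΛ}c‖²_{L²} + τ²‖Λ^m e^{τΛ}ρ‖²_{L²}‖Λ^{m+1/2}e^{τΛ}c‖²_{L²}] for any δ > 0. -/

import Mathlib

/-- Euclidean norm of a lattice point in ℤ². -/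
noncomputable def nz (k : ℤ × ℤ) : ℝ := Real.sqrt ((k.1 : ℝ)^2 + (k.2 : ℝ)^2)

/-- Dot product of lattice points. -/
def dz (a b : ℤ × ℤ) : ℝ := (a.1 : ℝ) * b.1 + (a.2 : ℝ) * b.2

lemma nz_nonneg (k : ℤ × ℤ) : 0 ≤ nz k := Real.sqrt_nonneg _

lemma nz_neg (k : ℤ × ℤ) : nz (-k) = nz k := by simp [nz]

lemma nz_eq_norm (k : ℤ × ℤ) : nz k = ‖(⟨k.1, k.2⟩ : ℂ)‖ := by
  rw [nz, Complex.norm_eq_sqrt_sq_add_sq]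

lemma nz_add_le (j k : ℤ × ℤ) : nz (j + k) ≤ nz j + nz k := by
  simp only [nz_eq_norm]
  refine le_trans (le_of_eq ?_) (norm_add_le _ _)
  congr 1
  apply Complex.ext <;> simp

lemma abs_fst_le_nz (k : ℤ × ℤ) : |(k.1 : ℝ)| ≤ nz k :=
  Real.abs_le_sqrt (by nlinarith [sq_nonneg (k.2 : ℝ)])

lemma abs_snd_le_nz (k : ℤ × ℤ) : |(k.2 : ℝ)| ≤ nz k :=
  Real.abs_le_sqrt (by nlinarith [sq_nonneg (k.1 : ℝ)])

lemma one_le_nz {k : ℤ × ℤ} (hk : k ≠ 0) : 1 ≤ nz k := by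
  rcases eq_or_ne k.1 0 with h | h
  · have h2 : k.2 ≠ 0 := fun h' => hk (Prod.ext h h')
    refine le_trans ?_ (abs_snd_le_nz k)
    exact_mod_cast Int.one_le_abs h2
  · refine le_trans ?_ (abs_fst_le_nz k)
    exact_mod_cast Int.one_le_abs h

lemma abs_dz_le (a b : ℤ × ℤ) : |dz a b| ≤ nz a * nz b := by
  rw [nz, nz, ← Real.sqrt_mul (by positivity)]
  refine Real.abs_le_sqrt ?_
  rw [dz]
  nlinarith [sq_nonneg ((a.1 : ℝ) * b.2 - a.2 * b.1)]

lemma summable_nz_rpow_neg {s : ℝ} (hs : 2 < s) : Summable fun k : ℤ × ℤ => nz k ^ (-s) := by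
  have h := EisensteinSeries.summable_one_div_norm_rpow hs
  rw [← (finTwoArrowEquiv ℤ).symm.summable_iff] at h
  refine Summable.of_nonneg_of_le (fun k => Real.rpow_nonneg (nz_nonneg k) _) (fun k => ?_) h
  rcases eq_or_ne k 0 with rfl | hk
  · have : nz 0 = 0 := by simp [nz]
    rw [this, Real.zero_rpow (by linarith)]
    exact Real.rpow_nonneg (norm_nonneg _) _
  · have hpos : 0 < ‖(finTwoArrowEquiv ℤ).symm k‖ := by
      rw [norm_pos_iff]
      intro h0
      exact hk (Prod.ext (by simpa using congrFun h0 0) (by simpa using congrFun h0 1))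
    refine Real.rpow_le_rpow_of_nonpos hpos ?_ (by linarith)
    rw [pi_norm_le_iff_of_nonneg (nz_nonneg k)]
    intro i
    fin_cases i
    · simpa [Int.norm_eq_abs] using abs_fst_le_nz k
    · simpa [Int.norm_eq_abs] using abs_snd_le_nz k

section Convolution

variable {ι : Type*}

lemma summable_mul_and_tsum_mul_le_sqrt {u v : ι → ℝ} (hu : ∀ i, 0 ≤ u i) (hv : ∀ i, 0 ≤ v i)
    (hu2 : Summable fun i => u i ^ 2) (hv2 : Summable fun i => v i ^ 2) :
    Summable (fun i => u i * v i) ∧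
      ∑' i, u i * v i ≤ √(∑' i, u i ^ 2) * √(∑' i, v i ^ 2) := by
  have h := Real.summable_and_inner_le_Lp_mul_Lq_tsum_of_nonneg (p := 2) (q := 2)
    Real.HolderConjugate.two_two hu hv (by simpa using hu2) (by simpa using hv2)
  simpa [Real.sqrt_eq_rpow] using h

variable [AddCommGroup ι]

/-- Young's inequality `ℓ¹ * ℓ² ⊂ ℓ²`, tested against an `ℓ²` sequence. -/
lemma summable_and_tsum_trilinear_le {u v F : ι → ℝ} (hu : ∀ i, 0 ≤ u i) (hv : ∀ i, 0 ≤ v i)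
    (hF : ∀ i, 0 ≤ F i) (hu1 : Summable u) (hv2 : Summable fun i => v i ^ 2)
    (hF2 : Summable fun i => F i ^ 2) :
    Summable (fun p : ι × ι => u p.1 * v p.2 * F (-(p.1 + p.2))) ∧
      ∑' p : ι × ι, u p.1 * v p.2 * F (-(p.1 + p.2)) ≤
        (∑' i, u i) * (√(∑' i, v i ^ 2) * √(∑' i, F i ^ 2)) := by
  have key (j : ι) : Summable (fun k => v k * F (-(j + k))) ∧
      ∑' k, v k * F (-(j + k)) ≤ √(∑' i, v i ^ 2) * √(∑' i, F i ^ 2) := by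
    have he (k : ι) : ((Equiv.addLeft j).trans (Equiv.neg ι)) k = -(j + k) := rfl
    have hs := ((Equiv.addLeft j).trans (Equiv.neg ι)).summable_iff.mpr hF2
    have ht := ((Equiv.addLeft j).trans (Equiv.neg ι)).tsum_eq fun i => F i ^ 2
    simp only [Function.comp_def, he] at hs ht
    rw [← ht]
    exact summable_mul_and_tsum_mul_le_sqrt hv (fun k => hF (-(j + k))) hv2 hs
  have hle (j : ι) : ∑' k, u j * v k * F (-(j + k)) ≤
      u j * (√(∑' i, v i ^ 2) * √(∑' i, F i ^ 2)) := by
    simp only [mul_assoc]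
    rw [tsum_mul_left]
    exact mul_le_mul_of_nonneg_left (key j).2 (hu j)
  have hnn (p : ι × ι) : 0 ≤ u p.1 * v p.2 * F (-(p.1 + p.2)) :=
    mul_nonneg (mul_nonneg (hu _) (hv _)) (hF _)
  have hfib (j : ι) : Summable fun k => u j * v k * F (-(j + k)) := by
    simpa only [mul_assoc] using (key j).1.mul_left (u j)
  have hbd := hu1.mul_right (√(∑' i, v i ^ 2) * √(∑' i, F i ^ 2))
  have houter : Summable fun j => ∑' k, u j * v k * F (-(j + k)) :=
    hbd.of_nonneg_of_le (fun j => tsum_nonneg fun k => hnn (j, k)) hle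
  have hs : Summable (fun p : ι × ι => u p.1 * v p.2 * F (-(p.1 + p.2))) :=
    (summable_prod_of_nonneg hnn).mpr ⟨hfib, houter⟩
  refine ⟨hs, ?_⟩
  rw [hs.tsum_prod' hfib, ← tsum_mul_right]
  exact houter.tsum_le_tsum hle hbd

lemma summable_and_tsum_trilinear_le' {u v F : ι → ℝ} (hu : ∀ i, 0 ≤ u i) (hv : ∀ i, 0 ≤ v i)
    (hF : ∀ i, 0 ≤ F i) (hu1 : Summable u) (hv2 : Summable fun i => v i ^ 2)
    (hF2 : Summable fun i => F i ^ 2) :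
    Summable (fun p : ι × ι => v p.1 * u p.2 * F (-(p.1 + p.2))) ∧
      ∑' p : ι × ι, v p.1 * u p.2 * F (-(p.1 + p.2)) ≤
        (∑' i, u i) * (√(∑' i, v i ^ 2) * √(∑' i, F i ^ 2)) := by
  have h := summable_and_tsum_trilinear_le hu hv hF hu1 hv2 hF2
  rw [← (Equiv.prodComm ι ι).summable_iff, ← (Equiv.prodComm ι ι).tsum_eq] at h
  simpa only [Function.comp_def, Equiv.prodComm_apply, Prod.fst_swap, Prod.snd_swap, add_comm,
    mul_comm] using h

end Convolution

/-- A sequence on `ℤ²` dominated by `|k|^{-m}` times an `ℓ²` sequence is in `ℓ¹` when `m > 1`. -/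
lemma summable_and_tsum_le_of_le_nz_rpow_mul {m : ℝ} (hm : 1 < m) {u v : ℤ × ℤ → ℝ}
    (hu : ∀ k, 0 ≤ u k) (hv : ∀ k, 0 ≤ v k) (hv2 : Summable fun k => v k ^ 2)
    (huv : ∀ k, u k ≤ nz k ^ (-m) * v k) :
    Summable u ∧ ∑' k, u k ≤ √(∑' k, nz k ^ (-(2 * m))) * √(∑' k, v k ^ 2) := by
  have hsq (k : ℤ × ℤ) : (nz k ^ (-m)) ^ 2 = nz k ^ (-(2 * m)) := by
    rw [← Real.rpow_mul_natCast (nz_nonneg k)]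
    congr 1
    push_cast
    ring
  have hS := summable_nz_rpow_neg (s := 2 * m) (by linarith)
  have h := summable_mul_and_tsum_mul_le_sqrt (fun k => Real.rpow_nonneg (nz_nonneg k) (-m)) hv
    (by simpa only [hsq] using hS) hv2
  simp only [hsq] at h
  have hsu := h.1.of_nonneg_of_le hu huv
  exact ⟨hsu, (hsu.tsum_le_tsum huv h.1).trans h.2⟩

lemma exp_le_exp_one_add_mul_exp {x : ℝ} (hx : 0 ≤ x) :
    Real.exp x ≤ Real.exp 1 + x * Real.exp x := by
  rcases le_total x 1 with h | h
  · have := Real.exp_le_exp.mpr h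
    have := mul_nonneg hx (Real.exp_pos x).le
    linarith
  · nlinarith [Real.exp_pos x, Real.exp_pos 1]

lemma rpow_le_two_rpow_mul_add {m x y z : ℝ} (hm : 0 ≤ m) (hx : 0 ≤ x) (hy : 0 ≤ y) (hz : 0 ≤ z)
    (h : z ≤ x + y) : z ^ m ≤ 2 ^ m * (x ^ m + y ^ m) := by
  have h2 : (0 : ℝ) ≤ 2 ^ m := Real.rpow_nonneg (by norm_num) _
  have hxm := Real.rpow_nonneg hx m
  have hym := Real.rpow_nonneg hy m
  rcases le_total x y with hxy | hxy
  · calc z ^ m ≤ (2 * y) ^ m := Real.rpow_le_rpow hz (by linarith) hm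
      _ = 2 ^ m * y ^ m := Real.mul_rpow (by norm_num) hy
      _ ≤ _ := mul_le_mul_of_nonneg_left (by linarith) h2
  · calc z ^ m ≤ (2 * x) ^ m := Real.rpow_le_rpow hz (by linarith) hm
      _ = 2 ^ m * x ^ m := Real.mul_rpow (by norm_num) hx
      _ ≤ _ := mul_le_mul_of_nonneg_left (by linarith) h2

/-- Frequency splitting of the weight: `|l|^m e^{τ|l|}` for `|l| ≤ |j| + |k|`, with the exponential
in `k` split into a bounded and a small part. -/
lemma rpow_mul_exp_le {m τ x y z : ℝ} (hm : 0 ≤ m) (hτ : 0 ≤ τ) (hx : 0 ≤ x) (hy : 0 ≤ y)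
    (hz : 0 ≤ z) (h : z ≤ x + y) :
    z ^ m * Real.exp (τ * z) ≤ 2 ^ m * (x ^ m + y ^ m) *
      (Real.exp (τ * x) * (Real.exp 1 + τ * y * Real.exp (τ * y))) := by
  have hexp : Real.exp (τ * z) ≤
      Real.exp (τ * x) * (Real.exp 1 + τ * y * Real.exp (τ * y)) :=
    calc Real.exp (τ * z) ≤ Real.exp (τ * x + τ * y) :=
          Real.exp_le_exp.mpr (by nlinarith)
      _ = Real.exp (τ * x) * Real.exp (τ * y) := Real.exp_add _ _
      _ ≤ _ := mul_le_mul_of_nonneg_left (exp_le_exp_one_add_mul_exp (by positivity))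
          (Real.exp_pos _).le
  exact mul_le_mul (rpow_le_two_rpow_mul_add hm hx hy hz h) hexp (Real.exp_pos _).le
    (by positivity)

lemma norm_gevrey_summand_le {m τ : ℝ} (hm : 1 < m) (hτ : 0 ≤ τ) {c ρ : ℤ × ℤ → ℂ}
    (hρ : ρ 0 = 0) (j k : ℤ × ℤ) :
    ‖c j * ρ k * c (-(j + k)) *
        (((dz (-(j + k)) k / (nz k) ^ 2) *
          (nz (-(j + k)) ^ (2 * m) * Real.exp (2 * τ * nz (-(j + k)))) : ℝ) : ℂ)‖ ≤
      2 ^ m *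
        (Real.exp 1 *
          ((Real.exp (τ * nz j) * ‖c j‖) * (nz k ^ (m - 1) * ‖ρ k‖) *
              (nz (-(j + k)) ^ (m + 1) * Real.exp (τ * nz (-(j + k))) * ‖c (-(j + k))‖) +
            (nz j ^ m * Real.exp (τ * nz j) * ‖c j‖) * (‖ρ k‖ / nz k) *
              (nz (-(j + k)) ^ (m + 1) * Real.exp (τ * nz (-(j + k))) * ‖c (-(j + k))‖)) +
         τ *
          ((Real.exp (τ * nz j) * ‖c j‖) * (nz k ^ m * Real.exp (τ * nz k) * ‖ρ k‖) *
              (nz (-(j + k)) ^ (m + 1) * Real.exp (τ * nz (-(j + k))) * ‖c (-(j + k))‖) +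
            (nz j ^ m * Real.exp (τ * nz j) * ‖c j‖) * (Real.exp (τ * nz k) * ‖ρ k‖) *
              (nz (-(j + k)) ^ (m + 1) * Real.exp (τ * nz (-(j + k))) * ‖c (-(j + k))‖))) := by
  rcases eq_or_ne k 0 with rfl | hk
  · simp [hρ]
  have hkpos : 0 < nz k := lt_of_lt_of_le one_pos (one_le_nz hk)
  have hl : nz (-(j + k)) ≤ nz j + nz k := by rw [nz_neg]; exact nz_add_le j k
  have hw := rpow_mul_exp_le (by linarith : 0 ≤ m) hτ (nz_nonneg j) (nz_nonneg k)
    (nz_nonneg (-(j + k))) hl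
  have hd := abs_dz_le (-(j + k)) k
  generalize -(j + k) = l at *
  have hl0 := nz_nonneg l
  have hd' : |dz l k| / nz k ^ 2 ≤ nz l / nz k := by
    rw [div_le_div_iff₀ (by positivity) hkpos]
    nlinarith
  have hpow : nz l * nz l ^ (2 * m) = nz l ^ m * nz l ^ (m + 1) := by
    rw [← Real.rpow_add_of_nonneg hl0 (by linarith) (by linarith), mul_comm,
      ← Real.rpow_add_one' hl0 (by linarith)]
    congr 1
    ring
  have hexp : Real.exp (2 * τ * nz l) = Real.exp (τ * nz l) * Real.exp (τ * nz l) := by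
    rw [← Real.exp_add]
    congr 1
    ring
  have hk1 : nz k ^ (m - 1) = nz k ^ m / nz k := Real.rpow_sub_one hkpos.ne' m
  have hlm := Real.rpow_nonneg hl0 (2 * m)
  have hlm1 := Real.rpow_nonneg hl0 (m + 1)
  rw [norm_mul, norm_mul, norm_mul, Complex.norm_real, Real.norm_eq_abs, abs_mul, abs_div,
    abs_of_nonneg (sq_nonneg (nz k)), abs_of_nonneg (by positivity : 0 ≤ nz l ^ (2 * m) * _)]
  calc ‖c j‖ * ‖ρ k‖ * ‖c l‖ *
        (|dz l k| / nz k ^ 2 * (nz l ^ (2 * m) * Real.exp (2 * τ * nz l)))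
      ≤ ‖c j‖ * ‖ρ k‖ * ‖c l‖ *
        (nz l / nz k * (nz l ^ (2 * m) * Real.exp (2 * τ * nz l))) := by gcongr
    _ = ‖c j‖ * (‖ρ k‖ / nz k) * (nz l ^ (m + 1) * Real.exp (τ * nz l) * ‖c l‖) *
        (nz l ^ m * Real.exp (τ * nz l)) := by
      rw [hexp]
      linear_combination (‖c j‖ * ‖ρ k‖ * ‖c l‖ / nz k * Real.exp (τ * nz l) ^ 2) * hpow
    _ ≤ ‖c j‖ * (‖ρ k‖ / nz k) * (nz l ^ (m + 1) * Real.exp (τ * nz l) * ‖c l‖) *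
        (2 ^ m * (nz j ^ m + nz k ^ m) *
          (Real.exp (τ * nz j) * (Real.exp 1 + τ * nz k * Real.exp (τ * nz k)))) := by
      gcongr
    _ = _ := by
      rw [hk1]
      field_simp
      ring

lemma mul_mul_add_le_young {D e δ f a b : ℝ} (hδ : 0 < δ) (he : 1 ≤ e) :
    D * f * (e * a + b) ≤ δ / 8 * f ^ 2 + (4 * D ^ 2 * e ^ 2 / δ + 1) * (a ^ 2 + b ^ 2) := by
  have h1 : D * f * (e * a + b) ≤ δ / 8 * f ^ 2 + 2 * D ^ 2 / δ * (e * a + b) ^ 2 := by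
    have : δ / 8 * f ^ 2 + 2 * D ^ 2 / δ * (e * a + b) ^ 2 - D * f * (e * a + b) =
        2 / δ * (δ / 4 * f - D * (e * a + b)) ^ 2 := by
      field_simp
      ring
    have : 0 ≤ 2 / δ * (δ / 4 * f - D * (e * a + b)) ^ 2 := by positivity
    linarith
  have h2 : (e * a + b) ^ 2 ≤ 2 * e ^ 2 * (a ^ 2 + b ^ 2) := by
    have : b ^ 2 ≤ e ^ 2 * b ^ 2 := le_mul_of_one_le_left (sq_nonneg b) (one_le_pow₀ he)
    nlinarith [sq_nonneg (e * a - b)]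
  have h3 : 2 * D ^ 2 / δ * (e * a + b) ^ 2 ≤
      2 * D ^ 2 / δ * (2 * e ^ 2 * (a ^ 2 + b ^ 2)) := by gcongr
  have h4 : 2 * D ^ 2 / δ * (2 * e ^ 2 * (a ^ 2 + b ^ 2)) =
      4 * D ^ 2 * e ^ 2 / δ * (a ^ 2 + b ^ 2) := by ring
  nlinarith [sq_nonneg a, sq_nonneg b]

/-- The trilinear Gevrey estimate for the electromigration term
`(e^{τΛ}Λ^m ∇·(c∇Φ), e^{τΛ}Λ^m c)_{L²}`, written in Fourier variables as
`-4π² Σ_{j+k+l=0} c_j ρ_k c_l (l·k/|k|²)|l|^{2m}e^{2τ|l|}` (Lemma 3.3 / 5.2). -/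
theorem gevrey_trilinear_estimate (m : ℝ) (hm : 1 < m) (δ : ℝ) (hδ : 0 < δ) :
    ∃ C > 0, ∀ (τ : ℝ), 0 ≤ τ → ∀ (c ρ : ℤ × ℤ → ℂ), c 0 = 0 → ρ 0 = 0 →
      Summable (fun k => (nz k ^ (m + 1) * Real.exp (τ * nz k) * ‖c k‖)^2) →
      Summable (fun k => (nz k ^ (m + 1/2) * Real.exp (τ * nz k) * ‖c k‖)^2) →
      Summable (fun k => (nz k ^ m * Real.exp (τ * nz k) * ‖c k‖)^2) →
      Summable (fun k => (nz k ^ m * Real.exp (τ * nz k) * ‖ρ k‖)^2) →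
      Summable (fun k => (nz k ^ (m - 1) * ‖ρ k‖)^2) →
      4 * Real.pi^2 *
        ‖∑' p : (ℤ × ℤ) × (ℤ × ℤ),
            c p.1 * ρ p.2 * c (-(p.1 + p.2)) *
              (((dz (-(p.1 + p.2)) p.2 / (nz p.2)^2) *
                (nz (-(p.1 + p.2)) ^ (2 * m) *
                  Real.exp (2 * τ * nz (-(p.1 + p.2)))) : ℝ) : ℂ)‖ ≤
        (δ / 8) * (∑' k, (nz k ^ (m + 1) * Real.exp (τ * nz k) * ‖c k‖)^2) +
        C * ((∑' k, (nz k ^ (m - 1) * ‖ρ k‖)^2) *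
               (∑' k, (nz k ^ m * Real.exp (τ * nz k) * ‖c k‖)^2) +
             τ^2 * (∑' k, (nz k ^ m * Real.exp (τ * nz k) * ‖ρ k‖)^2) *
               (∑' k, (nz k ^ (m + 1/2) * Real.exp (τ * nz k) * ‖c k‖)^2)) := by
  set S : ℝ := ∑' k : ℤ × ℤ, nz k ^ (-(2 * m)) with hS
  set D : ℝ := 4 * Real.pi ^ 2 * 2 ^ m * (2 * √S) with hD
  refine ⟨4 * D ^ 2 * Real.exp 1 ^ 2 / δ + 1, by positivity, ?_⟩
  intro τ hτ c ρ hc hρ sF sH sG sR sX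
  set A : ℤ × ℤ → ℝ := fun k => Real.exp (τ * nz k) * ‖c k‖ with hA
  set Q : ℤ × ℤ → ℝ := fun k => ‖ρ k‖ / nz k with hQ
  set W : ℤ × ℤ → ℝ := fun k => Real.exp (τ * nz k) * ‖ρ k‖ with hW
  set F : ℤ × ℤ → ℝ := fun k => nz k ^ (m + 1) * Real.exp (τ * nz k) * ‖c k‖ with hF
  set H : ℤ × ℤ → ℝ := fun k => nz k ^ (m + 1/2) * Real.exp (τ * nz k) * ‖c k‖ with hH
  set G : ℤ × ℤ → ℝ := fun k => nz k ^ m * Real.exp (τ * nz k) * ‖c k‖ with hG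
  set R : ℤ × ℤ → ℝ := fun k => nz k ^ m * Real.exp (τ * nz k) * ‖ρ k‖ with hR
  set X : ℤ × ℤ → ℝ := fun k => nz k ^ (m - 1) * ‖ρ k‖ with hX
  have hn (s : ℝ) (k : ℤ × ℤ) : 0 ≤ nz k ^ s := Real.rpow_nonneg (nz_nonneg k) s
  have nA (k) : 0 ≤ A k := by positivity
  have nQ (k) : 0 ≤ Q k := div_nonneg (norm_nonneg _) (nz_nonneg k)
  have nW (k) : 0 ≤ W k := by positivity
  have nF (k) : 0 ≤ F k := by have := hn (m + 1) k; positivity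
  have nG (k) : 0 ≤ G k := by have := hn m k; positivity
  have nR (k) : 0 ≤ R k := by have := hn m k; positivity
  have nX (k) : 0 ≤ X k := by have := hn (m - 1) k; positivity
  have hcancel {k : ℤ × ℤ} (hk : k ≠ 0) : nz k ^ (-m) * nz k ^ m = 1 := by
    have hkpos : 0 < nz k := lt_of_lt_of_le one_pos (one_le_nz hk)
    rw [← Real.rpow_add hkpos, neg_add_cancel, Real.rpow_zero]
  have hGH (k) : G k ≤ H k := by
    rcases eq_or_ne k 0 with rfl | hk
    · simp [hG, hH, hc]
    · have : nz k ^ m ≤ nz k ^ (m + 1/2) :=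
        Real.rpow_le_rpow_of_exponent_le (one_le_nz hk) (by linarith)
      simp only [hG, hH]
      gcongr
  have hGH2 : √(∑' k, G k ^ 2) ≤ √(∑' k, H k ^ 2) :=
    Real.sqrt_le_sqrt (sG.tsum_le_tsum (fun k => pow_le_pow_left₀ (nG k) (hGH k) 2) sH)
  have hAG := summable_and_tsum_le_of_le_nz_rpow_mul hm nA nG sG fun k => by
    rcases eq_or_ne k 0 with rfl | hk
    · simp [hG, hA, hc]
    · apply le_of_eq
      simp only [hG, hA]
      linear_combination (-(Real.exp (τ * nz k) * ‖c k‖)) * hcancel hk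
  have hQX := summable_and_tsum_le_of_le_nz_rpow_mul hm nQ nX sX fun k => by
    rcases eq_or_ne k 0 with rfl | hk
    · simp [hX, hQ, hρ]
    · have hkpos : 0 < nz k := lt_of_lt_of_le one_pos (one_le_nz hk)
      apply le_of_eq
      simp only [hX, hQ]
      rw [Real.rpow_sub_one hkpos.ne']
      linear_combination (-(‖ρ k‖ / nz k)) * hcancel hk
  have hWR := summable_and_tsum_le_of_le_nz_rpow_mul hm nW nR sR fun k => by
    rcases eq_or_ne k 0 with rfl | hk
    · simp [hR, hW, hρ]
    · apply le_of_eq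
      simp only [hR, hW]
      linear_combination (-(Real.exp (τ * nz k) * ‖ρ k‖)) * hcancel hk
  have t1 := summable_and_tsum_trilinear_le nA nX nF hAG.1 sX sF
  have t2 := summable_and_tsum_trilinear_le' nQ nG nF hQX.1 sG sF
  have t3 := summable_and_tsum_trilinear_le nA nR nF hAG.1 sR sF
  have t4 := summable_and_tsum_trilinear_le' nW nG nF hWR.1 sG sF
  have hsum := ((((t1.1.hasSum.add t2.1.hasSum).mul_left (Real.exp 1)).add
    ((t3.1.hasSum.add t4.1.hasSum).mul_left τ)).mul_left ((2 : ℝ) ^ m))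
  have hT := tsum_of_norm_bounded hsum fun p => norm_gevrey_summand_le (c := c) hm hτ hρ p.1 p.2
  have eF := Real.sq_sqrt (show 0 ≤ ∑' k, F k ^ 2 from tsum_nonneg fun k => sq_nonneg (F k))
  have eX := Real.sq_sqrt (show 0 ≤ ∑' k, X k ^ 2 from tsum_nonneg fun k => sq_nonneg (X k))
  have eG := Real.sq_sqrt (show 0 ≤ ∑' k, G k ^ 2 from tsum_nonneg fun k => sq_nonneg (G k))
  have eR := Real.sq_sqrt (show 0 ≤ ∑' k, R k ^ 2 from tsum_nonneg fun k => sq_nonneg (R k))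
  have eH := Real.sq_sqrt (show 0 ≤ ∑' k, H k ^ 2 from tsum_nonneg fun k => sq_nonneg (H k))
  have pF := Real.sqrt_nonneg (∑' k, F k ^ 2)
  have pX := Real.sqrt_nonneg (∑' k, X k ^ 2)
  have pG := Real.sqrt_nonneg (∑' k, G k ^ 2)
  have pR := Real.sqrt_nonneg (∑' k, R k ^ 2)
  have pS := Real.sqrt_nonneg S
  have b1 := t1.2.trans (mul_le_mul_of_nonneg_right hAG.2 (mul_nonneg pX pF))
  have b2 := t2.2.trans (mul_le_mul_of_nonneg_right hQX.2 (mul_nonneg pG pF))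
  have b3 := t3.2.trans (mul_le_mul_of_nonneg_right
    (hAG.2.trans (mul_le_mul_of_nonneg_left hGH2 pS)) (mul_nonneg pR pF))
  have b4 := t4.2.trans (mul_le_mul hWR.2 (mul_le_mul_of_nonneg_right hGH2 pF)
    (mul_nonneg pG pF) (mul_nonneg pS pR))
  change _ ≤ δ / 8 * (∑' k, F k ^ 2) + _ * ((∑' k, X k ^ 2) * (∑' k, G k ^ 2) +
    τ ^ 2 * (∑' k, R k ^ 2) * (∑' k, H k ^ 2))
  rw [← eF, ← eX, ← eG, ← eR, ← eH]
  generalize √(∑' k, F k ^ 2) = f at *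
  generalize √(∑' k, X k ^ 2) = x at *
  generalize √(∑' k, G k ^ 2) = g at *
  generalize √(∑' k, R k ^ 2) = r at *
  generalize √(∑' k, H k ^ 2) = h at *
  have hT2 := hT.trans (mul_le_mul_of_nonneg_left
    (add_le_add (mul_le_mul_of_nonneg_left (add_le_add b1 b2) (Real.exp_pos 1).le)
      (mul_le_mul_of_nonneg_left (add_le_add b3 b4) hτ)) (by positivity : (0 : ℝ) ≤ 2 ^ m))
  refine (mul_le_mul_of_nonneg_left hT2 (by positivity : 0 ≤ 4 * Real.pi ^ 2)).trans ?_
  refine le_trans (le_of_eq ?_) ((mul_mul_add_le_young (D := D) (f := f) (a := x * g)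
    (b := τ * (r * h)) hδ (Real.one_le_exp zero_le_one)).trans (le_of_eq ?_))
  · rw [hD, hS]
    ring
  · ring
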